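/- arXiv:1811.09183 — 2 statements merged into one kernel-verified Lean document; each statement's English description precedes it below -/
import Mathlib

section
/- Let E be a Banach space of cotype 2. Then every weakly 1-summable sequence (x_j)_{j=1}^∞ in E can be written as x_j = a_j z_j for some scalar sequence (a_j) ∈ ℓ_2 and some weakly 2-summable sequence (z_j) in E. -/
open scoped ENNReal NNReal BigOperators ZeroAtInfty

noncomputable section

/-- The `k`-th Rademacher function on `[0,1]`. -/
def Rademacher (k : ℕ) (t : ℝ) : ℝ := (-1 : ℝ) ^ ⌊(2 : ℝ) ^ (k + 1) * t⌋

/-- A Banach space `E` has cotype `q` (for `2 ≤ q < ∞`). -/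
def HasCotype (q : ℝ) (E : Type*) [NormedAddCommGroup E] [NormedSpace ℝ E] : Prop :=
  2 ≤ q ∧ ∃ C > 0, ∀ (n : ℕ) (x : Fin n → E),
    (∑ k : Fin n, ‖x k‖ ^ q) ^ (1 / q) ≤
      C * (∫ t in (0:ℝ)..(1:ℝ), ‖∑ k : Fin n, Rademacher k.1 t • x k‖ ^ 2) ^ ((1:ℝ) / 2)

/-- `cot E`, the infimum of the cotypes of `E` (`∞` if `E` has no finite cotype). -/
def cot (E : Type*) [NormedAddCommGroup E] [NormedSpace ℝ E] : ℝ≥0∞ :=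
  sInf {c : ℝ≥0∞ | ∃ q : ℝ, HasCotype q E ∧ c = ENNReal.ofReal q}

/-- Conjugate exponent in `ℝ≥0∞` : `p* = p/(p-1)`, with `1* = ∞` and `∞* = 1`. -/
def conjE (p : ℝ≥0∞) : ℝ≥0∞ := 1 + 1 / (p - 1)

/-- A sequence is weakly `p`-summable. -/
def WeaklySummable {E : Type*} [NormedAddCommGroup E] [NormedSpace ℝ E]
    (p : ℝ) (x : ℕ → E) : Prop :=
  ∀ φ : E →L[ℝ] ℝ, Summable fun j => |φ (x j)| ^ p

/-- `u : E → F` is absolutely `(q,p)`-summing. -/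
def AbsolutelySumming {E F : Type*} [NormedAddCommGroup E] [NormedSpace ℝ E]
    [NormedAddCommGroup F] [NormedSpace ℝ F] (q p : ℝ) (u : E →L[ℝ] F) : Prop :=
  ∀ x : ℕ → E, WeaklySummable p x → Summable fun j => ‖u (x j)‖ ^ q

/-- The weak `ℓ_p` norm of a sequence. -/
def weakNorm {E : Type*} [NormedAddCommGroup E] [NormedSpace ℝ E] (p : ℝ) (x : ℕ → E) : ℝ :=
  ⨆ φ : {φ : E →L[ℝ] ℝ // ‖φ‖ ≤ 1}, (∑' j, |φ.1 (x j)| ^ p) ^ (1 / p)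

/-- A continuous `m`-linear operator is multiple `(q,p)`-summing. -/
def MultipleSumming {m : ℕ} {E : Fin m → Type*} [∀ i, NormedAddCommGroup (E i)]
    [∀ i, NormedSpace ℝ (E i)] {F : Type*} [NormedAddCommGroup F] [NormedSpace ℝ F]
    (q p : ℝ) (T : ContinuousMultilinearMap ℝ E F) : Prop :=
  ∃ C > 0, ∀ x : (i : Fin m) → ℕ → E i, (∀ i, WeaklySummable p (x i)) →
    (Summable fun j : Fin m → ℕ => ‖T (fun i => x i (j i))‖ ^ q) ∧
    (∑' j : Fin m → ℕ, ‖T (fun i => x i (j i))‖ ^ q) ^ (1 / q) ≤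
      C * ∏ i, weakNorm p (x i)


theorem rademacher_zero_left {t : ℝ} (h0 : 0 ≤ t) (h1 : t < 1 / 2) : Rademacher 0 t = 1 := by
  have : ⌊(2 : ℝ) ^ (0 + 1) * t⌋ = 0 := by
    rw [Int.floor_eq_iff]; constructor <;> norm_num <;> linarith
  rw [Rademacher, this, zpow_zero]

theorem rademacher_zero_right {t : ℝ} (h0 : 1 / 2 ≤ t) (h1 : t < 1) : Rademacher 0 t = -1 := by
  have : ⌊(2 : ℝ) ^ (0 + 1) * t⌋ = 1 := by
    rw [Int.floor_eq_iff]; constructor <;> norm_num <;> linarith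
  rw [Rademacher, this, zpow_one]

theorem rademacher_succ (k : ℕ) (t : ℝ) : Rademacher (k + 1) t = Rademacher k (2 * t) := by
  rw [Rademacher, Rademacher, pow_succ _ (k + 1), mul_assoc]

theorem rademacher_sub_one (k : ℕ) (t : ℝ) : Rademacher k (t - 1) = Rademacher k t := by
  have : (2 : ℝ) ^ (k + 1) * (t - 1) = 2 ^ (k + 1) * t - ((2 ^ (k + 1) : ℤ) : ℝ) := by
    push_cast; ring
  rw [Rademacher, Rademacher, this, Int.floor_sub_intCast, zpow_sub₀ (by norm_num)]
  have h : Even ((2 : ℤ) ^ (k + 1)) := (even_two).pow_of_ne_zero (by omega)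
  rw [h.neg_one_zpow, div_one]

theorem eqOn_rademacher_left {m : ℕ} (F : (Fin (m + 1) → ℝ) → ℝ) {t : ℝ} (h0 : 0 ≤ t)
    (h1 : t < 1 / 2) :
    F (fun k => Rademacher k t) = F (Fin.cons 1 fun k : Fin m => Rademacher k (2 * t)) := by
  congr 1
  funext k
  refine Fin.cases ?_ (fun k => ?_) k
  · simpa using rademacher_zero_left h0 h1
  · simpa using rademacher_succ k t

theorem eqOn_rademacher_right {m : ℕ} (F : (Fin (m + 1) → ℝ) → ℝ) {t : ℝ} (h0 : 1 / 2 ≤ t)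
    (h1 : t < 1) :
    F (fun k => Rademacher k t) = F (Fin.cons (-1) fun k : Fin m => Rademacher k (2 * t - 1)) := by
  congr 1
  funext k
  refine Fin.cases ?_ (fun k => ?_) k
  · simpa using rademacher_zero_right h0 h1
  · simpa [rademacher_sub_one] using rademacher_succ k t

/-- A function of the first `m` Rademacher functions is integrable on `[0,1]`. -/
theorem intervalIntegrable_rademacher {m : ℕ} (F : (Fin m → ℝ) → ℝ) :
    IntervalIntegrable (fun t => F fun k => Rademacher k t) MeasureTheory.volume 0 1 := by
  induction m with
  | zero =>
    have : (fun t : ℝ => F fun k => Rademacher k t) = fun _ => F Fin.elim0 := by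
      funext t; congr 1; funext k; exact k.elim0
    rw [this]; exact intervalIntegrable_const
  | succ m ih =>
    have hl := (ih fun s => F (Fin.cons 1 s)).comp_mul_left (c := 2)
    have hr := ((ih fun s => F (Fin.cons (-1) s)).comp_sub_right 1).comp_mul_left (c := 2)
    norm_num at hl hr
    refine IntervalIntegrable.trans (b := 1 / 2) (hl.congr_uIoo fun t ht => ?_)
      (hr.congr_uIoo fun t ht => ?_)
    · rw [Set.uIoo_of_le (by norm_num)] at ht
      exact (eqOn_rademacher_left F ht.1.le ht.2).symm
    · rw [Set.uIoo_of_le (by norm_num)] at ht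
      exact (eqOn_rademacher_right F ht.1.le ht.2).symm

/-- Averaging over the value of the first Rademacher function. -/
theorem integral_rademacher_succ {m : ℕ} (F : (Fin (m + 1) → ℝ) → ℝ) :
    ∫ t in (0 : ℝ)..1, F (fun k => Rademacher k t) =
      ((∫ t in (0 : ℝ)..1, F (Fin.cons 1 fun k : Fin m => Rademacher k t)) +
        ∫ t in (0 : ℝ)..1, F (Fin.cons (-1) fun k : Fin m => Rademacher k t)) / 2 := by
  have hi := intervalIntegrable_rademacher F
  rw [← intervalIntegral.integral_add_adjacent_intervals (b := 1 / 2)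
    (hi.mono_set (by rw [Set.uIcc_of_le, Set.uIcc_of_le] <;> [apply Set.Icc_subset_Icc; skip; skip]
                     <;> norm_num))
    (hi.mono_set (by rw [Set.uIcc_of_le, Set.uIcc_of_le] <;> [apply Set.Icc_subset_Icc; skip; skip]
                     <;> norm_num))]
  have hl : ∫ t in (0 : ℝ)..1 / 2, F (fun k => Rademacher k t) =
      ∫ t in (0 : ℝ)..1 / 2, F (Fin.cons 1 fun k : Fin m => Rademacher k (2 * t)) :=
    intervalIntegral.integral_congr_Ioo_of_le (by norm_num) fun t ht => by
      exact eqOn_rademacher_left F ht.1.le ht.2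
  have hr : ∫ t in (1 / 2 : ℝ)..1, F (fun k => Rademacher k t) =
      ∫ t in (1 / 2 : ℝ)..1, F (Fin.cons (-1) fun k : Fin m => Rademacher k (2 * t - 1)) :=
    intervalIntegral.integral_congr_Ioo_of_le (by norm_num) fun t ht => by
      exact eqOn_rademacher_right F ht.1.le ht.2
  have hl' := intervalIntegral.integral_comp_mul_left (a := 0) (b := 1 / 2) (c := 2)
    (fun t => F (Fin.cons 1 fun k : Fin m => Rademacher k t)) (by norm_num)
  have hr' := intervalIntegral.integral_comp_mul_sub (a := 1 / 2) (b := 1) (c := 2)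
    (fun t => F (Fin.cons (-1) fun k : Fin m => Rademacher k t)) (by norm_num) 1
  rw [hl, hr, hl', hr']
  norm_num
  ring

/-- Khinchine's inequality for the fourth moment, with a constant term. -/
theorem integral_rademacher_pow_four_le {m : ℕ} (c : ℝ) (a : Fin m → ℝ) :
    ∫ t in (0 : ℝ)..1, (c + ∑ k : Fin m, Rademacher k t * a k) ^ 4 ≤
      c ^ 4 + 6 * c ^ 2 * ∑ k, a k ^ 2 + 3 * (∑ k, a k ^ 2) ^ 2 := by
  induction m generalizing c with
  | zero => simp
  | succ m ih =>
    rw [integral_rademacher_succ fun s => (c + ∑ k : Fin (m + 1), s k * a k) ^ 4]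
    have hp := ih (c + a 0) (Fin.tail a)
    have hm := ih (c - a 0) (Fin.tail a)
    simp only [Fin.sum_univ_succ, Fin.cons_zero, Fin.cons_succ, Fin.tail] at hp hm ⊢
    simp only [one_mul, neg_one_mul, ← add_assoc, ← sub_eq_add_neg]
    nlinarith [pow_nonneg (sq_nonneg (a 0)) 2]

/-- A Pietsch-type domination: a `2`-summing estimate for an operator on a finite dimensional
`ℓ_∞` yields a dominating probability measure. -/
theorem exists_dominating_measure {E ι : Type*} [NormedAddCommGroup E] [NormedSpace ℝ E]
    [Fintype ι] [Nonempty ι] (u : (ι → ℝ) →ₗ[ℝ] E) {P : ℝ} (hP : 0 < P)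
    (h : ∀ (m : ℕ) (f : Fin m → ι → ℝ) (B : ℝ), 0 < B → (∀ j, ∑ k, f k j ^ 2 ≤ B) →
      ∑ k, ‖u (f k)‖ ^ 2 ≤ P * B) :
    ∃ μ : ι → ℝ, (∀ j, 0 ≤ μ j) ∧ ∑ j, μ j = 1 ∧
      ∀ f, ‖u f‖ ^ 2 ≤ P * ∑ j, μ j * f j ^ 2 := by
  classical
  let w : (ι → ℝ) → ι → ℝ := fun f j => P * f j ^ 2 - ‖u f‖ ^ 2
  let s : Set (ι → ℝ) := Set.univ.pi fun _ => Set.Iio 0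
  have hs_mem {v : ι → ℝ} (hv : ∀ j, v j < 0) : v ∈ s := fun j _ => hv j
  have hdisj : Disjoint s (convexHull ℝ (Set.range w)) := by
    rw [Set.disjoint_left]
    intro v hv hvt
    obtain ⟨κ, _, c, z, hc0, -, hz, hsum⟩ := mem_convexHull_iff_exists_fintype.1 hvt
    choose f hf using hz
    let e := Fintype.equivFin κ
    let g : Fin (Fintype.card κ) → ι → ℝ := fun k => √(c (e.symm k)) • f (e.symm k)
    have hv' (j) : P * ∑ k, g k j ^ 2 - ∑ k, ‖u (g k)‖ ^ 2 < 0 := by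
      have : v j = P * ∑ k, g k j ^ 2 - ∑ k, ‖u (g k)‖ ^ 2 := by
        rw [← hsum, Finset.sum_apply, Finset.mul_sum, ← Finset.sum_sub_distrib, ← e.symm.sum_comp]
        refine Finset.sum_congr rfl fun k _ => ?_
        simp only [← hf, g, w, Pi.smul_apply, smul_eq_mul, map_smul, norm_smul, mul_pow,
          Real.norm_eq_abs, sq_abs, Real.sq_sqrt (hc0 _)]
        ring
      rw [← this]
      exact hv j trivial
    obtain ⟨i, hi⟩ := Finite.exists_max fun j => ∑ k, g k j ^ 2
    set B := ∑ k, g k i ^ 2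
    set S := ∑ k, ‖u (g k)‖ ^ 2
    have hB0 : 0 ≤ B := Finset.sum_nonneg fun k _ => sq_nonneg _
    have hBS : B < S / P := by rw [lt_div_iff₀ hP]; linarith [hv' i]
    have := h _ g ((B + S / P) / 2) (by linarith) fun j => (hi j).trans (by linarith)
    have hPS : P * (S / P) = S := by field_simp
    nlinarith [hv' i]
  obtain ⟨φ, r, hφs, hφt⟩ := geometric_hahn_banach_open
    (convex_pi fun _ _ => convex_Iio 0)
    (isOpen_set_pi Set.finite_univ fun _ _ => isOpen_Iio) (convex_convexHull ℝ _) hdisj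
  have hr : r ≤ 0 := by
    have h0 : w 0 = 0 := by funext j; simp [w]
    simpa using hφt 0 (subset_convexHull ℝ _ ⟨0, h0⟩)
  have hone : 0 < φ 1 := by
    have := hφs (-1) (hs_mem fun j => by simp)
    rw [map_neg] at this
    linarith
  have hr0 : 0 ≤ r := by
    refine le_of_forall_pos_lt_add fun ε hε => ?_
    have := hφs (-((ε / φ 1) • 1)) (hs_mem fun j => by simp; positivity)
    rw [map_neg, map_smul, smul_eq_mul, div_mul_cancel₀ _ hone.ne'] at this
    linarith
  have hsingle (j : ι) : 0 ≤ φ (Pi.single j 1) := by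
    refine le_of_forall_pos_lt_add fun ε hε => ?_
    have := hφs (-(Pi.single j 1) - (ε / φ 1) • 1) (hs_mem fun i => by
      have h1 : (0 : ℝ) ≤ (Pi.single j 1 : ι → ℝ) i := by
        rw [Pi.single_apply]; split_ifs <;> norm_num
      have h2 : 0 < ε / φ 1 := by positivity
      simp only [Pi.sub_apply, Pi.neg_apply, Pi.smul_apply, Pi.one_apply, smul_eq_mul, mul_one]
      linarith)
    rw [map_sub, map_neg, map_smul, smul_eq_mul, div_mul_cancel₀ _ hone.ne'] at this
    linarith
  have hφ (v : ι → ℝ) : φ v = ∑ j, φ (Pi.single j 1) * v j := by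
    conv_lhs => rw [pi_eq_sum_univ' v, map_sum]
    refine Finset.sum_congr rfl fun j _ => ?_
    rw [map_smul, smul_eq_mul, mul_comm]
  refine ⟨fun j => φ (Pi.single j 1) / φ 1, fun j => div_nonneg (hsingle j) hone.le, ?_,
    fun f => ?_⟩
  · rw [← Finset.sum_div, div_eq_one_iff_eq hone.ne', hφ 1]
    simp
  · have h1 : 0 ≤ φ (w f) := hr0.trans (hφt _ (subset_convexHull ℝ _ ⟨f, rfl⟩))
    have h2 : φ (w f) = P * ∑ j, φ (Pi.single j 1) * f j ^ 2 - φ 1 * ‖u f‖ ^ 2 := by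
      rw [hφ, hφ 1, Finset.mul_sum, Finset.sum_mul, ← Finset.sum_sub_distrib]
      refine Finset.sum_congr rfl fun j _ => ?_
      simp only [w, Pi.one_apply]
      ring
    have h3 : ∑ j, φ (Pi.single j 1) / φ 1 * f j ^ 2 =
        (∑ j, φ (Pi.single j 1) * f j ^ 2) / φ 1 := by
      rw [Finset.sum_div]
      exact Finset.sum_congr rfl fun j _ => by ring
    rw [h3, ← mul_div_assoc, le_div_iff₀ hone]
    linarith

/-- Truncating at height `L`: the bounded part is controlled by the `ℓ_∞` bound of `u` and the
rest by the fourth moment. -/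
theorem norm_sq_le_fourth_moment {E ι : Type*} [NormedAddCommGroup E] [NormedSpace ℝ E]
    [Fintype ι] {u : (ι → ℝ) →ₗ[ℝ] E} {M P L : ℝ} (hP : 0 < P) (hL : 0 < L)
    (hM : ∀ (L : ℝ) (f : ι → ℝ), 0 ≤ L → (∀ j, |f j| ≤ L) → ‖u f‖ ≤ M * L)
    {μ : ι → ℝ} (hμ : ∀ j, 0 ≤ μ j) (hu : ∀ f, ‖u f‖ ^ 2 ≤ P * ∑ j, μ j * f j ^ 2) (g : ι → ℝ) :
    ‖u g‖ ^ 2 ≤ 2 * M ^ 2 * L ^ 2 + 2 * P / L ^ 2 * ∑ j, μ j * g j ^ 4 := by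
  let g₁ : ι → ℝ := fun j => if |g j| ≤ L then g j else 0
  let g₂ : ι → ℝ := fun j => if |g j| ≤ L then 0 else g j
  have hg : g = g₁ + g₂ := by
    funext j; simp only [g₁, g₂, Pi.add_apply]; split_ifs <;> simp
  have h1 : ‖u g₁‖ ≤ M * L := hM L g₁ hL.le fun j => by
    simp only [g₁]; split_ifs with h
    · exact h
    · simpa using hL.le
  have h1' : ‖u g₁‖ ^ 2 ≤ M ^ 2 * L ^ 2 := by
    rw [← mul_pow]; exact pow_le_pow_left₀ (norm_nonneg _) h1 2
  have h2 : ‖u g₂‖ ^ 2 ≤ P / L ^ 2 * ∑ j, μ j * g j ^ 4 := by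
    refine (hu g₂).trans ?_
    rw [div_mul_eq_mul_div, mul_div_assoc]
    refine mul_le_mul_of_nonneg_left ?_ hP.le
    rw [Finset.sum_div]
    refine Finset.sum_le_sum fun j _ => ?_
    rw [mul_div_assoc]
    refine mul_le_mul_of_nonneg_left ?_ (hμ j)
    simp only [g₂]; split_ifs with h
    · simp only [ne_eq, OfNat.ofNat_ne_zero, not_false_eq_true, zero_pow]; positivity
    · rw [le_div_iff₀ (by positivity)]
      have : L ^ 2 ≤ g j ^ 2 := by
        rw [← sq_abs (g j)]; exact pow_le_pow_left₀ hL.le (not_le.1 h).le 2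
      nlinarith [sq_nonneg (g j)]
  have h3 : ‖u g‖ ≤ ‖u g₁‖ + ‖u g₂‖ := by
    conv_lhs => rw [hg, map_add]
    exact norm_add_le _ _
  have h4 : ‖u g‖ ^ 2 ≤ (‖u g₁‖ + ‖u g₂‖) ^ 2 := pow_le_pow_left₀ (norm_nonneg _) h3 2
  have h5 : 2 * P / L ^ 2 * ∑ j, μ j * g j ^ 4 = 2 * (P / L ^ 2 * ∑ j, μ j * g j ^ 4) := by ring
  nlinarith [sq_nonneg (‖u g₁‖ - ‖u g₂‖)]

/-- In the presence of cotype `2`, a domination constant `P` can be roughly halved. -/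
theorem exists_dominating_measure_improve {E ι : Type*} [NormedAddCommGroup E] [NormedSpace ℝ E]
    [Fintype ι] [Nonempty ι] {u : (ι → ℝ) →ₗ[ℝ] E} {C M P : ℝ} (hC : 0 < C) (hP : 0 < P)
    (hcot : ∀ (n : ℕ) (x : Fin n → E), ∑ k, ‖x k‖ ^ 2 ≤
      C ^ 2 * ∫ t in (0 : ℝ)..1, ‖∑ k : Fin n, Rademacher k t • x k‖ ^ 2)
    (hM : ∀ (L : ℝ) (f : ι → ℝ), 0 ≤ L → (∀ j, |f j| ≤ L) → ‖u f‖ ≤ M * L)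
    (h : ∃ μ : ι → ℝ, (∀ j, 0 ≤ μ j) ∧ ∑ j, μ j = 1 ∧
      ∀ f, ‖u f‖ ^ 2 ≤ P * ∑ j, μ j * f j ^ 2) :
    ∃ μ : ι → ℝ, (∀ j, 0 ≤ μ j) ∧ ∑ j, μ j = 1 ∧
      ∀ f, ‖u f‖ ^ 2 ≤ (24 * C ^ 4 * M ^ 2 + P / 2) * ∑ j, μ j * f j ^ 2 := by
  obtain ⟨μ, hμ, hμ1, hu⟩ := h
  refine exists_dominating_measure u (by positivity) fun m f B hB hf => ?_
  have hL2 : √(12 * C ^ 2 * B) ^ 2 = 12 * C ^ 2 * B := Real.sq_sqrt (by positivity)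
  have hL : 0 < √(12 * C ^ 2 * B) := Real.sqrt_pos.2 (by positivity)
  set L := √(12 * C ^ 2 * B)
  have hpt (t : ℝ) : ‖∑ k : Fin m, Rademacher k t • u (f k)‖ ^ 2 ≤ 2 * M ^ 2 * L ^ 2 +
      2 * P / L ^ 2 * ∑ j, μ j * (0 + ∑ k : Fin m, Rademacher k t * f k j) ^ 4 := by
    have := norm_sq_le_fourth_moment hP hL hM hμ hu (∑ k : Fin m, Rademacher k t • f k)
    simpa [map_sum, map_smul, Finset.sum_apply] using this
  have hi (j : ι) := intervalIntegrable_rademacher (m := m)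
    fun s => μ j * (0 + ∑ k, s k * f k j) ^ 4
  have hint : ∫ t in (0 : ℝ)..1, ‖∑ k : Fin m, Rademacher k t • u (f k)‖ ^ 2 ≤
      2 * M ^ 2 * L ^ 2 + 2 * P / L ^ 2 * (3 * B ^ 2) := by
    calc _ ≤ ∫ t in (0 : ℝ)..1, (2 * M ^ 2 * L ^ 2 +
          2 * P / L ^ 2 * ∑ j, μ j * (0 + ∑ k : Fin m, Rademacher k t * f k j) ^ 4) :=
        intervalIntegral.integral_mono_on zero_le_one
          (intervalIntegrable_rademacher fun s => ‖∑ k : Fin m, s k • u (f k)‖ ^ 2)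
          (intervalIntegrable_rademacher fun s => 2 * M ^ 2 * L ^ 2 +
            2 * P / L ^ 2 * ∑ j, μ j * (0 + ∑ k : Fin m, s k * f k j) ^ 4)
          fun t _ => hpt t
      _ = 2 * M ^ 2 * L ^ 2 + 2 * P / L ^ 2 *
          ∑ j, μ j * ∫ t in (0 : ℝ)..1, (0 + ∑ k : Fin m, Rademacher k t * f k j) ^ 4 := by
        rw [intervalIntegral.integral_add intervalIntegrable_const
          (intervalIntegrable_rademacher fun s =>
            2 * P / L ^ 2 * ∑ j, μ j * (0 + ∑ k : Fin m, s k * f k j) ^ 4),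
          intervalIntegral.integral_const, intervalIntegral.integral_const_mul,
          intervalIntegral.integral_finsetSum fun j _ => hi j]
        simp only [intervalIntegral.integral_const_mul, sub_zero, one_smul]
      _ ≤ 2 * M ^ 2 * L ^ 2 + 2 * P / L ^ 2 * ∑ j, μ j * (3 * B ^ 2) := by
        gcongr with j _
        · exact hμ j
        · refine (integral_rademacher_pow_four_le 0 fun k => f k j).trans ?_
          have h0 : 0 ≤ ∑ k, f k j ^ 2 := Finset.sum_nonneg fun k _ => sq_nonneg _
          have := pow_le_pow_left₀ h0 (hf j) 2
          linarith
      _ = _ := by rw [← Finset.sum_mul, hμ1, one_mul]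
  refine (hcot m fun k => u (f k)).trans ((mul_le_mul_of_nonneg_left hint (sq_nonneg C)).trans ?_)
  rw [hL2]
  apply le_of_eq
  field_simp
  ring

/-- Operators from a finite dimensional `ℓ_∞` to a space of cotype `2` are dominated with a
constant which does not depend on the dimension. -/
theorem exists_dominating_measure_of_cotype {E ι : Type*} [NormedAddCommGroup E]
    [NormedSpace ℝ E] [Fintype ι] [Nonempty ι] (u : (ι → ℝ) →ₗ[ℝ] E) {C M : ℝ} (hC : 0 < C)
    (hcot : ∀ (n : ℕ) (x : Fin n → E), ∑ k, ‖x k‖ ^ 2 ≤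
      C ^ 2 * ∫ t in (0 : ℝ)..1, ‖∑ k : Fin n, Rademacher k t • x k‖ ^ 2)
    (hM : ∀ (L : ℝ) (f : ι → ℝ), 0 ≤ L → (∀ j, |f j| ≤ L) → ‖u f‖ ≤ M * L) :
    ∃ μ : ι → ℝ, (∀ j, 0 ≤ μ j) ∧ ∑ j, μ j = 1 ∧
      ∀ f, ‖u f‖ ^ 2 ≤ (48 * C ^ 4 * M ^ 2 + 1) * ∑ j, μ j * f j ^ 2 := by
  classical
  let T : Set ℝ := {P | 0 < P ∧ ∃ μ : ι → ℝ, (∀ j, 0 ≤ μ j) ∧ ∑ j, μ j = 1 ∧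
    ∀ f, ‖u f‖ ^ 2 ≤ P * ∑ j, μ j * f j ^ 2}
  have hTbdd : BddBelow T := ⟨0, fun P hP => hP.1.le⟩
  have hTne : T.Nonempty := by
    have hn : (0 : ℝ) < Fintype.card ι := by exact_mod_cast Fintype.card_pos
    refine ⟨Fintype.card ι * (1 + M ^ 2), by positivity, fun _ => (Fintype.card ι : ℝ)⁻¹,
      fun _ => by positivity, by simp [hn.ne'], fun f => ?_⟩
    have h0 : 0 ≤ ∑ j, f j ^ 2 := Finset.sum_nonneg fun j _ => sq_nonneg _
    have h1 := hM (√(∑ j, f j ^ 2)) f (Real.sqrt_nonneg _) fun j =>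
      Real.abs_le_sqrt (Finset.single_le_sum (f := fun j => f j ^ 2)
        (fun j _ => sq_nonneg _) (Finset.mem_univ j))
    have h2 := pow_le_pow_left₀ (norm_nonneg _) h1 2
    rw [mul_pow, Real.sq_sqrt h0] at h2
    rw [← Finset.mul_sum]
    field_simp
    nlinarith
  have hT (P) (hP : P ∈ T) : 24 * C ^ 4 * M ^ 2 + P / 2 ∈ T :=
    ⟨by have := hP.1; positivity, exists_dominating_measure_improve hC hP.1 hcot hM hP.2⟩
  have hinf : sInf T ≤ 48 * C ^ 4 * M ^ 2 := by
    have : 2 * (sInf T - 24 * C ^ 4 * M ^ 2) ≤ sInf T := le_csInf hTne fun P hP => by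
      linarith [csInf_le hTbdd (hT P hP)]
    linarith
  obtain ⟨P, ⟨hP, μ, hμ, hμ1, hu⟩, hlt⟩ := exists_lt_of_csInf_lt hTne
    (hinf.trans_lt (lt_add_one _))
  refine ⟨μ, hμ, hμ1, fun f => (hu f).trans (mul_le_mul_of_nonneg_right hlt.le ?_)⟩
  exact Finset.sum_nonneg fun j _ => mul_nonneg (hμ j) (sq_nonneg _)

theorem HasCotype.sum_norm_sq_le {E : Type*} [NormedAddCommGroup E] [NormedSpace ℝ E]
    (h : HasCotype 2 E) : ∃ C > 0, ∀ (n : ℕ) (x : Fin n → E), ∑ k, ‖x k‖ ^ 2 ≤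
      C ^ 2 * ∫ t in (0 : ℝ)..1, ‖∑ k : Fin n, Rademacher k t • x k‖ ^ 2 := by
  obtain ⟨-, C, hC, hx⟩ := h
  refine ⟨C, hC, fun n x => ?_⟩
  have := hx n x
  simp only [Real.rpow_two, ← Real.sqrt_eq_rpow] at this
  have h0 : 0 ≤ ∑ k, ‖x k‖ ^ 2 := Finset.sum_nonneg fun k _ => sq_nonneg _
  have h1 : 0 ≤ ∫ t in (0 : ℝ)..1, ‖∑ k : Fin n, Rademacher k t • x k‖ ^ 2 :=
    intervalIntegral.integral_nonneg zero_le_one fun t _ => sq_nonneg _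
  have h2 := pow_le_pow_left₀ (Real.sqrt_nonneg _) this 2
  rwa [mul_pow, Real.sq_sqrt h0, Real.sq_sqrt h1] at h2

/-- A weakly `1`-summable sequence induces uniformly bounded operators on the spaces `ℓ_∞^n`. -/
theorem WeaklySummable.exists_norm_sum_le {E : Type*} [NormedAddCommGroup E] [NormedSpace ℝ E]
    {x : ℕ → E} (hx : WeaklySummable 1 x) :
    ∃ M, ∀ (n : ℕ) (L : ℝ) (f : Fin n → ℝ), 0 ≤ L → (∀ j, |f j| ≤ L) →
      ‖∑ j, f j • x j‖ ≤ M * L := by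
  let v : {p : Σ n, Fin n → ℝ // ∀ j, |p.2 j| ≤ 1} → E := fun p => ∑ j, p.1.2 j • x j
  obtain ⟨M, hM⟩ := banach_steinhaus (g := fun p => NormedSpace.inclusionInDoubleDual ℝ E (v p))
    fun φ => ⟨∑' j, |φ (x j)|, fun p => by
      have hs : Summable fun j => |φ (x j)| := by simpa using hx φ
      calc ‖NormedSpace.inclusionInDoubleDual ℝ E (v p) φ‖ = |∑ j, p.1.2 j * φ (x j)| := by
            simp [v, NormedSpace.dual_def]
        _ ≤ ∑ j, |p.1.2 j * φ (x j)| := Finset.abs_sum_le_sum_abs _ _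
        _ ≤ ∑ j : Fin p.1.1, |φ (x j)| := Finset.sum_le_sum fun j _ => by
            rw [abs_mul]
            exact mul_le_of_le_one_left (abs_nonneg _) (p.2 j)
        _ = ∑ j ∈ Finset.range p.1.1, |φ (x j)| := (Finset.sum_range fun j => |φ (x j)|).symm
        _ ≤ _ := hs.sum_le_tsum _ fun j _ => abs_nonneg _⟩
  have hv (p) : ‖v p‖ ≤ M := by
    rw [← (NormedSpace.inclusionInDoubleDualLi (E := E) ℝ).norm_map]
    exact hM p
  refine ⟨M, fun n L f hL hf => ?_⟩
  rcases hL.eq_or_lt with rfl | hL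
  · have : f = 0 := by funext j; simpa using hf j
    simp [this]
  · have := hv ⟨⟨n, fun j => f j / L⟩, fun j => by
      rw [abs_div, abs_of_pos hL]; exact div_le_one_of_le₀ (hf j) hL.le⟩
    have h2 : ∑ j, f j • x j = L • ∑ j, (f j / L) • x j := by
      rw [Finset.smul_sum]
      refine Finset.sum_congr rfl fun j _ => ?_
      rw [smul_smul, mul_div_cancel₀ _ hL.ne']
    rw [h2, norm_smul, Real.norm_of_nonneg hL.le, mul_comm]
    exact mul_le_mul_of_nonneg_right this hL.le

theorem sum_range_ite_lt {A : Type*} [AddCommMonoid A] {n N : ℕ} (h : n ≤ N) (g : ℕ → A) :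
    ∑ j ∈ Finset.range N, (if j < n then g j else 0) = ∑ j ∈ Finset.range n, g j := by
  rw [← Finset.sum_filter]
  congr 1
  ext j
  simp only [Finset.mem_filter, Finset.mem_range]
  omega

/-- The domination of a weakly `1`-summable sequence in a space of cotype `2` by a summable
sequence of weights. -/
theorem exists_dominating_weights {E : Type*} [NormedAddCommGroup E] [NormedSpace ℝ E]
    (hcot : HasCotype 2 E) {x : ℕ → E} (hx : WeaklySummable 1 x) :
    ∃ K : ℝ, ∃ ν : ℕ → ℝ, (∀ j, 0 ≤ ν j) ∧ Summable ν ∧ ∀ (n : ℕ) (f : ℕ → ℝ),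
      ‖∑ j ∈ Finset.range n, f j • x j‖ ^ 2 ≤ K * ∑ j ∈ Finset.range n, ν j * f j ^ 2 := by
  obtain ⟨C, hC, hcot⟩ := hcot.sum_norm_sq_le
  obtain ⟨M, hM⟩ := hx.exists_norm_sum_le
  set K := 48 * C ^ 4 * M ^ 2 + 1
  have hfin (N : ℕ) : ∃ ν : ℕ → ℝ, (∀ j, 0 ≤ ν j) ∧
      (∀ n ≤ N + 1, ∑ j ∈ Finset.range n, ν j ≤ 1) ∧ ∀ n ≤ N + 1, ∀ f : ℕ → ℝ,
      ‖∑ j ∈ Finset.range n, f j • x j‖ ^ 2 ≤ K * ∑ j ∈ Finset.range n, ν j * f j ^ 2 := by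
    obtain ⟨μ, hμ, hμ1, hu⟩ := exists_dominating_measure_of_cotype
      (Fintype.linearCombination ℝ fun j : Fin (N + 1) => x j) hC hcot
      (fun L f hL hf => by simpa [Fintype.linearCombination_apply] using hM _ L f hL hf)
    let ν : ℕ → ℝ := fun j => if h : j < N + 1 then μ ⟨j, h⟩ else 0
    have hν0 (j) : 0 ≤ ν j := by
      simp only [ν]; split_ifs
      · exact hμ _
      · exact le_rfl
    have hν (j : Fin (N + 1)) : ν j = μ j := dif_pos j.2
    refine ⟨ν, hν0, fun n hn => ?_, fun n hn f => ?_⟩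
    · calc _ ≤ ∑ j ∈ Finset.range (N + 1), ν j :=
            Finset.sum_le_sum_of_subset_of_nonneg (Finset.range_mono hn) fun j _ _ => hν0 j
        _ = 1 := by rw [Finset.sum_range, ← hμ1]; exact Finset.sum_congr rfl fun j _ => hν j
    · have := hu fun j => if (j : ℕ) < n then f j else 0
      rw [Fintype.linearCombination_apply] at this
      simp only [← hν, ite_smul, zero_smul, ite_pow, mul_ite, ne_eq, OfNat.ofNat_ne_zero,
        not_false_eq_true, zero_pow, mul_zero] at this
      rwa [← Finset.sum_range fun j => if j < n then f j • x j else 0,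
        ← Finset.sum_range fun j => if j < n then ν j * f j ^ 2 else 0,
        sum_range_ite_lt hn, sum_range_ite_lt hn] at this
  choose ν hν0 hν1 hν using hfin
  have hcpt : IsCompact (Set.univ.pi fun _ : ℕ => Set.Icc (0 : ℝ) 1) :=
    isCompact_univ_pi fun _ => isCompact_Icc
  have hmem (N : ℕ) : (fun j => if j < N + 1 then ν N j else 0) ∈
      Set.univ.pi fun _ : ℕ => Set.Icc (0 : ℝ) 1 := fun j _ => by
    dsimp only
    split_ifs with h
    · exact ⟨hν0 N j, (Finset.single_le_sum (fun i _ => hν0 N i)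
        (Finset.mem_range.2 h)).trans (hν1 N _ le_rfl)⟩
    · simp
  obtain ⟨w, hw, ψ, hψ, hlim⟩ := hcpt.tendsto_subseq hmem
  rw [tendsto_pi_nhds] at hlim
  have hlim' (j : ℕ) : Filter.Tendsto (fun k => ν (ψ k) j) Filter.atTop (nhds (w j)) := by
    refine (hlim j).congr' ?_
    filter_upwards [Filter.eventually_ge_atTop j] with k hk
    have : j < ψ k + 1 := Nat.lt_succ_of_le (hk.trans hψ.le_apply)
    exact if_pos this
  have hw0 (j) : 0 ≤ w j := (hw j trivial).1
  have hev (n : ℕ) : ∀ᶠ k in Filter.atTop, n ≤ ψ k + 1 := by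
    filter_upwards [Filter.eventually_ge_atTop n] with k hk
    exact (hk.trans hψ.le_apply).trans (Nat.le_succ _)
  refine ⟨K, w, hw0, summable_of_sum_range_le (c := 1) hw0 fun n => ?_, fun n f => ?_⟩
  · exact le_of_tendsto (tendsto_finsetSum _ fun j _ => hlim' j)
      ((hev n).mono fun k hk => hν1 _ n hk)
  · exact ge_of_tendsto
      ((tendsto_finsetSum _ fun j _ => (hlim' j).mul_const (f j ^ 2)).const_mul K)
      ((hev n).mono fun k hk => hν _ n hk f)

/-- if `E` has cotype 2, every weakly `1`-summable sequence factors as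
`x_j = a_j z_j` with `(a_j) ∈ ℓ₂` and `(z_j)` weakly `2`-summable. -/
theorem stmt13 (E : Type*) [NormedAddCommGroup E] [NormedSpace ℝ E] [CompleteSpace E]
    (hcot : HasCotype 2 E) :
    ∀ x : ℕ → E, WeaklySummable 1 x →
      ∃ (c : ℕ → ℝ) (z : ℕ → E), (Summable fun j => |c j| ^ (2 : ℝ)) ∧
        WeaklySummable 2 z ∧ ∀ j, x j = c j • z j := by
  intro x hx
  obtain ⟨K, ν, hν0, hνs, hν⟩ := exists_dominating_weights hcot hx
  have hzero (j : ℕ) (hj : ν j = 0) : x j = 0 := by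
    have := hν (j + 1) (Pi.single j 1)
    have hl : ∑ i ∈ Finset.range (j + 1), (Pi.single j 1 : ℕ → ℝ) i • x i = x j := by
      simp [Pi.single_apply]
    have hr : ∑ i ∈ Finset.range (j + 1), ν i * (Pi.single j 1 : ℕ → ℝ) i ^ 2 = 0 := by
      simp [Pi.single_apply, hj]
    rw [hl, hr, mul_zero] at this
    simpa using this
  refine ⟨fun j => √(ν j), fun j => (√(ν j))⁻¹ • x j, ?_, fun φ => ?_, fun j => ?_⟩
  · simpa [Real.sq_sqrt (hν0 _)] using hνs
  · simp only [Real.rpow_two, sq_abs]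
    set b : ℕ → ℝ := fun j => φ ((√(ν j))⁻¹ • x j) with hb
    refine summable_of_sum_range_le (c := ‖φ‖ ^ 2 * |K|) (fun j => sq_nonneg _) fun n => ?_
    have hS0 : 0 ≤ ∑ j ∈ Finset.range n, b j ^ 2 := Finset.sum_nonneg fun j _ => sq_nonneg _
    have hφ : ∑ j ∈ Finset.range n, b j ^ 2 =
        φ (∑ j ∈ Finset.range n, (b j * (√(ν j))⁻¹) • x j) := by
      rw [map_sum]
      refine Finset.sum_congr rfl fun j _ => ?_
      rw [mul_smul, map_smul, smul_eq_mul, sq]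
    have hw : ∑ j ∈ Finset.range n, ν j * (b j * (√(ν j))⁻¹) ^ 2 ≤
        ∑ j ∈ Finset.range n, b j ^ 2 := Finset.sum_le_sum fun j _ => by
      rw [mul_pow, inv_pow, Real.sq_sqrt (hν0 j), mul_left_comm]
      exact mul_le_of_le_one_right (sq_nonneg _) mul_inv_le_one
    have hw0 : 0 ≤ ∑ j ∈ Finset.range n, ν j * (b j * (√(ν j))⁻¹) ^ 2 :=
      Finset.sum_nonneg fun j _ => mul_nonneg (hν0 j) (sq_nonneg _)
    have hsq : (∑ j ∈ Finset.range n, b j ^ 2) ^ 2 ≤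
        ‖φ‖ ^ 2 * |K| * ∑ j ∈ Finset.range n, b j ^ 2 := by
      calc _ ≤ (‖φ‖ * ‖∑ j ∈ Finset.range n, (b j * (√(ν j))⁻¹) • x j‖) ^ 2 :=
            pow_le_pow_left₀ hS0 (hφ.le.trans ((le_abs_self _).trans (φ.le_opNorm _))) 2
        _ ≤ ‖φ‖ ^ 2 * (|K| * ∑ j ∈ Finset.range n, b j ^ 2) := by
          rw [mul_pow]
          refine mul_le_mul_of_nonneg_left ((hν n _).trans ?_) (sq_nonneg _)
          exact mul_le_mul (le_abs_self K) hw hw0 (abs_nonneg K)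
        _ = _ := by ring
    rcases hS0.eq_or_lt with h | h
    · rw [← h]; positivity
    · rw [sq] at hsq
      exact le_of_mul_le_mul_right hsq h
  · rcases (hν0 j).eq_or_lt with h | h
    · simp [hzero j h.symm]
    · rw [smul_smul, mul_inv_cancel₀ (Real.sqrt_pos.2 h).ne', one_smul]

end
end

section
/- Let E be a Banach space of cotype q for some q > 2, and let r > q. Then every weakly 1-summable sequence (x_j)_{j=1}^∞ in E can be written as x_j = a_j z_j for some scalar sequence (a_j) ∈ ℓ_r and some weakly r*-summable sequence (z_j) in E. -/
open scoped ENNReal NNReal BigOperators ZeroAtInfty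

noncomputable section

/-- The partial sums of a weakly `1`-summable sequence with coefficients in `[-1, 1]` are uniformly
bounded. -/
lemma WeaklySummable.exists_norm_sum_smul_le {E : Type*} [NormedAddCommGroup E] [NormedSpace ℝ E]
    {x : ℕ → E} (hx : WeaklySummable 1 x) :
    ∃ M : ℝ, ∀ (s : Finset ℕ) (b : ℕ → ℝ), (∀ j ∈ s, |b j| ≤ 1) → ‖∑ j ∈ s, b j • x j‖ ≤ M := by
  let ι := {i : Finset ℕ × (ℕ → ℝ) // ∀ j ∈ i.1, |i.2 j| ≤ 1}
  let g : ι → StrongDual ℝ (StrongDual ℝ E) := fun i =>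
    NormedSpace.inclusionInDoubleDualLi ℝ (∑ j ∈ i.1.1, i.1.2 j • x j)
  obtain ⟨M, hM⟩ : ∃ M, ∀ i, ‖g i‖ ≤ M := by
    refine banach_steinhaus fun φ => ⟨∑' j, |φ (x j)|, fun i => ?_⟩
    have hs : Summable fun j => |φ (x j)| := by simpa using hx φ
    change ‖φ (∑ j ∈ i.1.1, i.1.2 j • x j)‖ ≤ _
    rw [map_sum]
    refine (norm_sum_le _ _).trans (le_trans (Finset.sum_le_sum fun j hj => ?_)
      (hs.sum_le_tsum i.1.1 fun _ _ => abs_nonneg _))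
    rw [map_smul, norm_smul, Real.norm_eq_abs, Real.norm_eq_abs]
    exact mul_le_of_le_one_left (abs_nonneg _) (i.2 j hj)
  refine ⟨M, fun s b hb => ?_⟩
  have h := hM ⟨(s, b), hb⟩
  rwa [LinearIsometry.norm_map] at h

lemma abs_Rademacher (k : ℕ) (t : ℝ) : |Rademacher k t| = 1 := by
  simp [Rademacher, abs_zpow]

/-- In a space of cotype `q`, the operator induced by a weakly `1`-summable sequence is
`(q, 1)`-summing. -/
lemma HasCotype.exists_sum_norm_rpow_le {E : Type*} [NormedAddCommGroup E] [NormedSpace ℝ E]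
    {q : ℝ} (hcot : HasCotype q E) {x : ℕ → E} (hx : WeaklySummable 1 x) :
    ∃ B : ℝ, ∀ (s : Finset ℕ) (n : ℕ) (f : Fin n → ℕ → ℝ), (∀ j ∈ s, ∑ k, |f k j| ≤ 1) →
      ∑ k, ‖∑ j ∈ s, f k j • x j‖ ^ q ≤ B := by
  obtain ⟨hq, C, hC, hcot⟩ := hcot
  obtain ⟨M, hM⟩ := hx.exists_norm_sum_smul_le
  have hM0 : 0 ≤ M := by simpa using hM ∅ 0 (by simp)
  refine ⟨(C * M) ^ q, fun s n f hf => ?_⟩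
  have hint : ∫ t in (0:ℝ)..1, ‖∑ k : Fin n, Rademacher k.1 t • ∑ j ∈ s, f k j • x j‖ ^ 2
      ≤ M ^ 2 := by
    refine (le_abs_self _).trans ?_
    rw [← Real.norm_eq_abs]
    refine (intervalIntegral.norm_integral_le_of_norm_le_const (C := M ^ 2)
      fun t _ => ?_).trans (by simp)
    rw [norm_pow, norm_norm]
    have heq : ∑ k : Fin n, Rademacher k.1 t • ∑ j ∈ s, f k j • x j
        = ∑ j ∈ s, (∑ k : Fin n, Rademacher k.1 t * f k j) • x j := by
      simp_rw [Finset.smul_sum, Finset.sum_smul, smul_smul]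
      exact Finset.sum_comm
    rw [heq]
    gcongr
    refine hM _ _ fun j hj => (Finset.abs_sum_le_sum_abs _ _).trans ?_
    simpa [abs_mul, abs_Rademacher] using hf j hj
  have hS : 0 ≤ ∑ k, ‖∑ j ∈ s, f k j • x j‖ ^ q := Finset.sum_nonneg fun k _ => by positivity
  have h1 : (∑ k, ‖∑ j ∈ s, f k j • x j‖ ^ q) ^ (1 / q) ≤ C * M := by
    refine (hcot n _).trans ?_
    gcongr
    rw [← Real.sqrt_eq_rpow]
    exact Real.sqrt_le_iff.2 ⟨hM0, hint⟩
  have h2 := Real.rpow_le_rpow (by positivity) h1 (by linarith : (0:ℝ) ≤ q)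
  rwa [← Real.rpow_mul hS, one_div_mul_cancel (by linarith), Real.rpow_one] at h2

/-- A Young inequality: `a ^ (q - 1) * b ≤ (1 - 1 / q) * a ^ q + (1 / q) * b ^ q`, with
denominators cleared. -/
lemma Real.mul_rpow_sub_one_mul_le {q a b : ℝ} (hq : 1 < q) (ha : 0 ≤ a) (hb : 0 ≤ b) :
    q * (a ^ (q - 1) * b) ≤ (q - 1) * a ^ q + b ^ q := by
  have h := Real.geom_mean_le_arith_mean2_weighted (w₁ := 1 - 1 / q) (w₂ := 1 / q)
    (p₁ := a ^ q) (p₂ := b ^ q)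
    (by rw [sub_nonneg, div_le_one (by linarith)]; exact hq.le) (by positivity)
    (by positivity) (by positivity) (by ring)
  rw [← Real.rpow_mul ha, ← Real.rpow_mul hb, mul_one_div_cancel (by linarith), Real.rpow_one,
    show q * (1 - 1 / q) = q - 1 by field_simp] at h
  calc q * (a ^ (q - 1) * b) ≤ q * ((1 - 1 / q) * a ^ q + 1 / q * b ^ q) := by gcongr
    _ = (q - 1) * a ^ q + b ^ q := by field_simp

/-- Approximate Pisier domination on a finite set of indices. -/
lemma exists_approx_dominating_weights {E : Type*} [NormedAddCommGroup E] [NormedSpace ℝ E]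
    {q : ℝ} (hq : 1 < q) {x : ℕ → E} {B : ℝ} {s : Finset ℕ}
    (hB : ∀ (n : ℕ) (f : Fin n → ℕ → ℝ), (∀ j ∈ s, ∑ k, |f k j| ≤ 1) →
      ∑ k, ‖∑ j ∈ s, f k j • x j‖ ^ q ≤ B) {ε : ℝ} (hε : 0 < ε) :
    ∃ w : ℕ → ℝ, (∀ j, 0 ≤ w j) ∧ (∀ t : Finset ℕ, ∑ j ∈ t, w j ≤ B) ∧
      ∀ A ⊆ s, ‖∑ j ∈ A, x j‖ ^ q ≤ ε + q * ∑ j ∈ A, w j := by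
  let V : Set ℝ := {v | ∃ (n : ℕ) (f : Fin n → ℕ → ℝ), (∀ j ∈ s, ∑ k, |f k j| ≤ 1) ∧
    v = ∑ k, ‖∑ j ∈ s, f k j • x j‖ ^ q}
  have hVne : V.Nonempty := ⟨0, 0, fun _ _ => 0, by simp, by simp⟩
  have hVbdd : BddAbove V := ⟨B, by rintro _ ⟨n, f, hf, rfl⟩; exact hB n f hf⟩
  have hVle : sSup V ≤ B := csSup_le hVne (by rintro _ ⟨n, f, hf, rfl⟩; exact hB n f hf)
  have hle : ∀ (n : ℕ) (f : Fin n → ℕ → ℝ), (∀ j ∈ s, ∑ k, |f k j| ≤ 1) →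
      ∑ k, ‖∑ j ∈ s, f k j • x j‖ ^ q ≤ sSup V := fun n f hf => le_csSup hVbdd ⟨n, f, hf, rfl⟩
  obtain ⟨_, ⟨n, f, hf, rfl⟩, hS⟩ := exists_lt_of_lt_csSup hVne (sub_lt_self (sSup V) hε)
  set a : Fin n → ℝ := fun k => ‖∑ j ∈ s, f k j • x j‖
  choose φ hφ1 hφ2 using fun k => exists_dual_vector'' ℝ (∑ j ∈ s, f k j • x j)
  let ν : ℕ → ℝ := fun j => ∑ k, a k ^ (q - 1) * (f k j * φ k (x j))
  have hν : ∀ g : ℕ → ℝ, ∑ j ∈ s, g j * ν j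
      = ∑ k, a k ^ (q - 1) * φ k (∑ j ∈ s, (f k j * g j) • x j) := by
    intro g
    simp only [ν, map_sum, map_smul, smul_eq_mul, Finset.mul_sum]
    rw [Finset.sum_comm]
    refine Finset.sum_congr rfl fun k _ => Finset.sum_congr rfl fun j _ => by ring
  have hνle : ∀ g : ℕ → ℝ, q * ∑ j ∈ s, g j * ν j
      ≤ (q - 1) * ∑ k, a k ^ q + ∑ k, ‖∑ j ∈ s, (f k j * g j) • x j‖ ^ q := by
    intro g
    rw [hν, Finset.mul_sum, Finset.mul_sum, ← Finset.sum_add_distrib]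
    refine Finset.sum_le_sum fun k _ => le_trans ?_
      (Real.mul_rpow_sub_one_mul_le hq (norm_nonneg _) (norm_nonneg _))
    gcongr
    refine (le_abs_self _).trans ?_
    exact ((φ k).le_of_opNorm_le (hφ1 k) _).trans (by rw [one_mul])
  have hν1 : ∑ j ∈ s, ν j = ∑ k, a k ^ q := by
    have h := hν 1
    simp only [Pi.one_apply, one_mul, mul_one] at h
    rw [h]
    refine Finset.sum_congr rfl fun k _ => ?_
    rw [hφ2]
    change a k ^ (q - 1) * a k = _
    rw [← Real.rpow_add_one' (norm_nonneg _) (by linarith)]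
    simp [a]
  have hSle : ∑ k, a k ^ q ≤ sSup V := hle n f hf
  refine ⟨fun j => if j ∈ s then |ν j| else 0, fun j => by dsimp only; split_ifs <;> positivity,
    fun t => ?_, fun A hA => ?_⟩
  · have h1 : ∑ j ∈ t, (if j ∈ s then |ν j| else 0) ≤ ∑ j ∈ s, |ν j| := by
      rw [← Finset.sum_filter]
      exact Finset.sum_le_sum_of_subset_of_nonneg (fun j hj => (Finset.mem_filter.1 hj).2)
        fun _ _ _ => abs_nonneg _
    let g : ℕ → ℝ := fun j => SignType.sign (ν j)
    have hg : ∀ j, |g j| ≤ 1 := fun j => by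
      rcases lt_trichotomy (ν j) 0 with h | h | h <;> simp [g, h]
    have h2 : ∑ k, ‖∑ j ∈ s, (f k j * g j) • x j‖ ^ q ≤ sSup V := by
      refine hle n _ fun j hj => le_trans (Finset.sum_le_sum fun k _ => ?_) (hf j hj)
      rw [abs_mul]
      exact mul_le_of_le_one_right (abs_nonneg _) (hg j)
    have h3 := hνle g
    simp only [g, sign_mul_self] at h3
    have h4 : (q - 1) * ∑ k, a k ^ q ≤ (q - 1) * sSup V :=
      mul_le_mul_of_nonneg_left hSle (by linarith)
    have h5 : q * ∑ j ∈ s, |ν j| ≤ q * sSup V := by linarith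
    linarith [le_of_mul_le_mul_left h5 (by linarith)]
  · let g : ℕ → ℝ := fun j => if j ∈ A then 0 else 1
    let i : ℕ → ℝ := fun j => if j ∈ A then 1 else 0
    have h1 := hle (n + 1) (Fin.cons i fun k j => f k j * g j) (fun j hj => by
      rw [Fin.sum_univ_succ]
      by_cases hjA : j ∈ A <;> simp [i, g, hjA, hf j hj])
    rw [Fin.sum_univ_succ] at h1
    simp only [Fin.cons_zero, Fin.cons_succ] at h1
    have h2 : ∑ j ∈ s, i j • x j = ∑ j ∈ A, x j := by
      simp [i, ite_smul, Finset.sum_ite_mem, Finset.inter_eq_right.2 hA]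
    rw [h2] at h1
    have h3 := hνle g
    have h4 : ∑ j ∈ s, g j * ν j = ∑ j ∈ s, ν j - ∑ j ∈ A, ν j := by
      rw [← Finset.sum_sdiff (f := ν) hA, add_sub_cancel_right, ← Finset.sum_sdiff hA,
        Finset.sum_eq_zero (s := A), add_zero]
      · exact Finset.sum_congr rfl fun j hj => by simp [g, (Finset.mem_sdiff.1 hj).2]
      · exact fun j hj => by simp [g, hj]
    have h5 : ∑ j ∈ A, ν j ≤ ∑ j ∈ A, if j ∈ s then |ν j| else 0 :=
      Finset.sum_le_sum fun j hj => by rw [if_pos (hA hj)]; exact le_abs_self _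
    have h6 := mul_le_mul_of_nonneg_left h5 (by linarith : 0 ≤ q)
    rw [h4, hν1] at h3
    linarith

/-- Pisier domination on `ℕ`, obtained from the finite version by compactness. -/
lemma exists_dominating_weights_s14 {E : Type*} [NormedAddCommGroup E] [NormedSpace ℝ E]
    {q : ℝ} (hq : 1 < q) {x : ℕ → E} {B : ℝ}
    (hB : ∀ (s : Finset ℕ) (n : ℕ) (f : Fin n → ℕ → ℝ), (∀ j ∈ s, ∑ k, |f k j| ≤ 1) →
      ∑ k, ‖∑ j ∈ s, f k j • x j‖ ^ q ≤ B) :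
    ∃ w : ℕ → ℝ, (∀ j, 0 ≤ w j) ∧ Summable w ∧
      ∀ A : Finset ℕ, ‖∑ j ∈ A, x j‖ ^ q ≤ q * ∑ j ∈ A, w j := by
  choose w hw0 hwB hw using fun N : ℕ => exists_approx_dominating_weights hq (hB (Finset.range N))
    (Nat.one_div_pos_of_nat (α := ℝ) (n := N))
  have hK : IsCompact (Set.univ.pi fun _ : ℕ => Set.Icc (0 : ℝ) B) :=
    isCompact_univ_pi fun _ => isCompact_Icc
  obtain ⟨v, -, σ, hσ, hv⟩ := hK.tendsto_subseq (x := w)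
    fun N j _ => ⟨hw0 N j, by simpa using hwB N {j}⟩
  have hvj : ∀ j, Filter.Tendsto (fun N => w (σ N) j) Filter.atTop (nhds (v j)) :=
    fun j => (tendsto_pi_nhds.1 hv) j
  have hsum : ∀ A : Finset ℕ, Filter.Tendsto (fun N => ∑ j ∈ A, w (σ N) j) Filter.atTop
      (nhds (∑ j ∈ A, v j)) := fun A => tendsto_finsetSum A fun j _ => hvj j
  have hv0 : ∀ j, 0 ≤ v j := fun j => ge_of_tendsto' (hvj j) fun N => hw0 _ j
  refine ⟨v, hv0, summable_of_sum_le hv0 (c := B) fun A => le_of_tendsto' (hsum A)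
    fun N => hwB _ A, fun A => ?_⟩
  have hlim : Filter.Tendsto (fun N => 1 / ((σ N : ℝ) + 1) + q * ∑ j ∈ A, w (σ N) j) Filter.atTop
      (nhds (0 + q * ∑ j ∈ A, v j)) :=
    ((tendsto_one_div_add_atTop_nhds_zero_nat (𝕜 := ℝ)).comp hσ.tendsto_atTop).add
      ((hsum A).const_mul q)
  rw [zero_add] at hlim
  obtain ⟨N₀, hN₀⟩ := A.exists_nat_subset_range
  refine ge_of_tendsto hlim ?_
  filter_upwards [Filter.eventually_ge_atTop N₀] with N hN
  exact hw _ A (hN₀.trans (Finset.range_subset_range.2 (hN.trans (hσ.id_le N))))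

/-- A weak-type bound for `y` relative to a summable weight `w` gives strong-type summability for
a strictly smaller exponent. -/
lemma summable_mul_div_rpow {q β : ℝ} (hq : 1 < q) (hβ : 0 < β) (hβq : β < 1 / (q - 1))
    {y w : ℕ → ℝ} (hy : ∀ j, 0 ≤ y j) (hw : ∀ j, 0 ≤ w j) (hws : Summable w) {K : ℝ}
    (hK : 0 ≤ K) (h : ∀ A : Finset ℕ, (∑ j ∈ A, y j) ^ q ≤ K * ∑ j ∈ A, w j) :
    Summable fun j => y j * (y j / w j) ^ β := by
  have hq1 : 0 < q - 1 := by linarith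
  set γ := 1 / (q - 1) with hγ
  set θ : ℝ := 2 ^ (β - γ) with hθ
  have hθ0 : 0 ≤ θ := by positivity
  have hθ1 : θ < 1 := Real.rpow_lt_one_of_one_lt_of_neg one_lt_two (by linarith)
  have hlevel : ∀ (m : ℕ) (A : Finset ℕ), (∀ j ∈ A, 2 ^ m * w j ≤ y j) →
      (2 ^ (m + 1) : ℝ) ^ β * ∑ j ∈ A, y j ≤ 2 ^ β * K ^ γ * θ ^ m := by
    intro m A hA
    set Y := ∑ j ∈ A, y j with hY
    have hY0 : 0 ≤ Y := Finset.sum_nonneg fun j _ => hy j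
    have h1 : 2 ^ m * ∑ j ∈ A, w j ≤ Y := by rw [Finset.mul_sum]; exact Finset.sum_le_sum hA
    have h2 : Y ≤ (K * (2 ^ m)⁻¹) ^ γ := by
      rcases hY0.eq_or_lt with h0 | hpos
      · rw [← h0]; positivity
      have h3 : Y ^ (q - 1) * Y ≤ K * (2 ^ m)⁻¹ * Y := by
        rw [← Real.rpow_add_one' hY0 (by linarith), sub_add_cancel]
        refine (h A).trans ?_
        rw [mul_assoc]
        gcongr
        rwa [inv_mul_eq_div, le_div_iff₀' (by positivity)]
      have h4 := Real.rpow_le_rpow (by positivity) (le_of_mul_le_mul_right h3 hpos)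
        (by positivity : 0 ≤ γ)
      rwa [← Real.rpow_mul hY0, hγ, mul_one_div_cancel hq1.ne', Real.rpow_one] at h4
    calc (2 ^ (m + 1) : ℝ) ^ β * Y ≤ (2 ^ (m + 1) : ℝ) ^ β * (K * (2 ^ m)⁻¹) ^ γ := by gcongr
      _ = 2 ^ β * K ^ γ * θ ^ m := by
        rw [Real.mul_rpow hK (by positivity), Real.inv_rpow (by positivity), pow_succ,
          Real.mul_rpow (by positivity) (by positivity), hθ, Real.rpow_sub two_pos, div_pow,
          Real.rpow_pow_comm two_pos.le, Real.rpow_pow_comm two_pos.le]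
        ring
  have hw0 : ∀ j, w j = 0 → y j = 0 := fun j hj => by
    have h1 := h {j}
    simp only [Finset.sum_singleton, hj, mul_zero] at h1
    exact (Real.rpow_eq_zero (hy j) (by linarith)).1 (h1.antisymm (Real.rpow_nonneg (hy j) q))
  refine summable_of_sum_le (c := ∑' j, w j + 2 ^ β * K ^ γ * (1 - θ)⁻¹)
    (fun j => mul_nonneg (hy j) (Real.rpow_nonneg (div_nonneg (hy j) (hw j)) _)) fun s => ?_
  obtain ⟨N, hN⟩ : ∃ N : ℕ, ∀ j ∈ s, y j / w j < 2 ^ N := by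
    obtain ⟨N, hN⟩ := pow_unbounded_of_one_lt (∑ j ∈ s, y j / w j) one_lt_two
    exact ⟨N, fun j hj => (Finset.single_le_sum
      (f := fun j => y j / w j) (fun j _ => div_nonneg (hy j) (hw j)) hj).trans_lt hN⟩
  have hpt : ∀ j ∈ s, y j * (y j / w j) ^ β ≤ w j + ∑ m ∈ Finset.range N,
      if 2 ^ m * w j ≤ y j then (2 ^ (m + 1) : ℝ) ^ β * y j else 0 := by
    intro j hj
    have hnn : ∀ m ∈ Finset.range N,
        0 ≤ if 2 ^ m * w j ≤ y j then (2 ^ (m + 1) : ℝ) ^ β * y j else 0 := fun m _ => by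
      have := hy j
      split_ifs <;> positivity
    rcases (hw j).eq_or_lt with h0 | hpos
    · rw [hw0 j h0.symm, zero_mul, ← h0, zero_add]
      simp
    have hg : 0 ≤ y j / w j := div_nonneg (hy j) hpos.le
    rcases le_total (y j / w j) 1 with h1 | h1
    · have h2 : y j * (y j / w j) ^ β ≤ y j :=
        mul_le_of_le_one_right (hy j) (Real.rpow_le_one hg h1 hβ.le)
      linarith [Finset.sum_nonneg hnn, (div_le_one hpos).1 h1]
    · obtain ⟨m, hm1, hm2⟩ := exists_nat_pow_near h1 (one_lt_two (α := ℝ))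
      have hmN : m ∈ Finset.range N := Finset.mem_range.2
        ((pow_lt_pow_iff_right₀ (one_lt_two (α := ℝ))).1 (hm1.trans_lt (hN j hj)))
      have h2 := Finset.single_le_sum hnn hmN
      rw [if_pos ((le_div_iff₀ hpos).1 hm1)] at h2
      have h3 : y j * (y j / w j) ^ β ≤ (2 ^ (m + 1) : ℝ) ^ β * y j := by
        rw [mul_comm]
        have := hy j
        gcongr
      linarith
  calc ∑ j ∈ s, y j * (y j / w j) ^ β
      ≤ ∑ j ∈ s, w j + ∑ m ∈ Finset.range N, ∑ j ∈ s,
        if 2 ^ m * w j ≤ y j then (2 ^ (m + 1) : ℝ) ^ β * y j else 0 := by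
        rw [Finset.sum_comm, ← Finset.sum_add_distrib]
        exact Finset.sum_le_sum hpt
    _ ≤ ∑' j, w j + ∑ m ∈ Finset.range N, 2 ^ β * K ^ γ * θ ^ m := by
        refine add_le_add (hws.sum_le_tsum s fun j _ => hw j) (Finset.sum_le_sum fun m _ => ?_)
        rw [← Finset.sum_filter, ← Finset.mul_sum]
        exact hlevel m _ fun j hj => (Finset.mem_filter.1 hj).2
    _ ≤ ∑' j, w j + 2 ^ β * K ^ γ * (1 - θ)⁻¹ := by
        rw [← Finset.mul_sum, ← tsum_geometric_of_lt_one hθ0 hθ1]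
        gcongr
        exact (summable_geometric_of_lt_one hθ0 hθ1).sum_le_tsum _ fun m _ => by positivity

lemma sum_abs_apply_rpow_le {E : Type*} [NormedAddCommGroup E] [NormedSpace ℝ E]
    {q : ℝ} (hq : 1 < q) {x : ℕ → E} {w : ℕ → ℝ} (hw0 : ∀ j, 0 ≤ w j)
    (hw : ∀ A : Finset ℕ, ‖∑ j ∈ A, x j‖ ^ q ≤ q * ∑ j ∈ A, w j) (φ : E →L[ℝ] ℝ)
    (A : Finset ℕ) :
    (∑ j ∈ A, |φ (x j)|) ^ q ≤ (2 * ‖φ‖) ^ q * q * ∑ j ∈ A, w j := by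
  have hq0 : 0 < q := by linarith
  set R := q * ∑ j ∈ A, w j with hR
  have hR0 : 0 ≤ R := mul_nonneg hq0.le (Finset.sum_nonneg fun j _ => hw0 j)
  have hsub : ∀ A' ⊆ A, |∑ j ∈ A', φ (x j)| ≤ ‖φ‖ * R ^ (1 / q) := by
    intro A' hA'
    rw [← map_sum, ← Real.norm_eq_abs]
    refine (φ.le_opNorm _).trans ?_
    gcongr
    rw [one_div, Real.le_rpow_inv_iff_of_pos (norm_nonneg _) hR0 hq0]
    refine (hw A').trans ?_
    rw [hR]
    gcongr
    exact fun j _ _ => hw0 j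
  have hsplit : ∑ j ∈ A, |φ (x j)| ≤ 2 * ‖φ‖ * R ^ (1 / q) := by
    rw [← Finset.sum_filter_add_sum_filter_not A (fun j => 0 ≤ φ (x j))]
    have h1 : ∑ j ∈ A with 0 ≤ φ (x j), |φ (x j)| = ∑ j ∈ A with 0 ≤ φ (x j), φ (x j) :=
      Finset.sum_congr rfl fun j hj => abs_of_nonneg (Finset.mem_filter.1 hj).2
    have h2 : ∑ j ∈ A with ¬ 0 ≤ φ (x j), |φ (x j)| = -∑ j ∈ A with ¬ 0 ≤ φ (x j), φ (x j) := by
      rw [← Finset.sum_neg_distrib]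
      exact Finset.sum_congr rfl fun j hj =>
        abs_of_nonpos (le_of_not_ge (Finset.mem_filter.1 hj).2)
    have h3 := hsub _ (Finset.filter_subset (fun j => 0 ≤ φ (x j)) A)
    have h4 := hsub _ (Finset.filter_subset (fun j => ¬ 0 ≤ φ (x j)) A)
    rw [h1, h2]
    linarith [le_abs_self (∑ j ∈ A with 0 ≤ φ (x j), φ (x j)),
      neg_le_abs (∑ j ∈ A with ¬ 0 ≤ φ (x j), φ (x j))]
  refine (Real.rpow_le_rpow (Finset.sum_nonneg fun _ _ => abs_nonneg _) hsplit hq0.le).trans ?_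
  rw [Real.mul_rpow (by positivity) (by positivity), ← Real.rpow_mul hR0,
    one_div_mul_cancel hq0.ne', Real.rpow_one, hR, mul_assoc]

/-- if `E` has cotype `q > 2` and `r > q`, every weakly `1`-summable sequence
factors as `x_j = a_j z_j` with `(a_j) ∈ ℓ_r` and `(z_j)` weakly `r*`-summable. -/
theorem stmt14 (E : Type*) [NormedAddCommGroup E] [NormedSpace ℝ E] [CompleteSpace E]
    (q : ℝ) (hq : 2 < q) (hcot : HasCotype q E) (r : ℝ) (hr : q < r) :
    ∀ x : ℕ → E, WeaklySummable 1 x →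
      ∃ (c : ℕ → ℝ) (z : ℕ → E), (Summable fun j => |c j| ^ r) ∧
        WeaklySummable (r / (r - 1)) z ∧ ∀ j, x j = c j • z j := by
  intro x hx
  have hq1 : 1 < q := by linarith
  have hr0 : 0 < r := by linarith
  have hr1 : 0 < r - 1 := by linarith
  obtain ⟨B, hB⟩ := hcot.exists_sum_norm_rpow_le hx
  obtain ⟨w, hw0, hws, hw⟩ := exists_dominating_weights_s14 hq1 hB
  refine ⟨fun j => w j ^ (1 / r), fun j => (w j ^ (1 / r))⁻¹ • x j, ?_, fun φ => ?_, fun j => ?_⟩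
  · refine hws.congr fun j => ?_
    rw [abs_of_nonneg (Real.rpow_nonneg (hw0 j) _), ← Real.rpow_mul (hw0 j),
      one_div_mul_cancel hr0.ne', Real.rpow_one]
  · refine (summable_mul_div_rpow hq1 (β := 1 / (r - 1)) (by positivity)
      (one_div_lt_one_div_of_lt (by linarith) (by linarith)) (fun j => abs_nonneg (φ (x j))) hw0 hws
      (by positivity) (sum_abs_apply_rpow_le hq1 hw0 hw φ)).congr fun j => ?_
    have hexp : r / (r - 1) = 1 / (r - 1) + 1 := by field_simp; ring
    rw [map_smul, smul_eq_mul, abs_mul, abs_of_nonneg (inv_nonneg.2 (Real.rpow_nonneg (hw0 j) _)),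
      Real.mul_rpow (inv_nonneg.2 (Real.rpow_nonneg (hw0 j) _)) (abs_nonneg _),
      Real.inv_rpow (Real.rpow_nonneg (hw0 j) _), ← Real.rpow_mul (hw0 j),
      show 1 / r * (r / (r - 1)) = 1 / (r - 1) by field_simp, hexp,
      Real.rpow_add_one' (abs_nonneg _) (by positivity), Real.div_rpow (abs_nonneg _) (hw0 j)]
    ring
  · rcases (hw0 j).eq_or_lt with h0 | hpos
    · have h1 := hw {j}
      simp only [Finset.sum_singleton, ← h0, mul_zero] at h1
      have h2 := (Real.rpow_eq_zero (norm_nonneg (x j)) (by linarith)).1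
        (h1.antisymm (Real.rpow_nonneg (norm_nonneg _) q))
      simp [norm_eq_zero.1 h2]
    · exact (smul_inv_smul₀ (Real.rpow_pos_of_pos hpos _).ne' (x j)).symm

end
end
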